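/- arXiv:2506.17527 — 3 statements merged into one kernel-verified Lean document; each statement's English description precedes it below -/
import Mathlib

section
/- Suppose β > 2(δ+α) − 1. Then the total variation distance between the marginal law of A under the planted measure ℙ and the Erdős–Rényi law ℚ = G(n,q_n) tends to 0 as n → ∞. Consequently, it is information-theoretically impossible to achieve even weak detection between ℙ and ℚ. -/
open Finset Filter
open scoped Classical symmDiff

noncomputable section

namespace NoisyHypergraph

/-- The set of unordered pairs of distinct vertices of `[n]`, encoded as 2-element subsets. -/
def pairs (n : ℕ) : Finset (Finset (Fin n)) :=
  (Finset.univ : Finset (Fin n)).powersetCard 2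

/-- The set of `d`-element subsets of `[n]` (potential hyperedges). -/
def dsets (n d : ℕ) : Finset (Finset (Fin n)) :=
  (Finset.univ : Finset (Fin n)).powersetCard d

/-- Projection of a hypergraph: all pairs of distinct vertices contained in some hyperedge. -/
def proj (n : ℕ) (H : Finset (Finset (Fin n))) : Finset (Finset (Fin n)) :=
  (pairs n).filter fun e => ∃ Ψ ∈ H, e ⊆ Ψ

/-- Mass function of `μ_{n,d,s}`: each `d`-subset included independently with probability `s`. -/
def mu (n d : ℕ) (s : ℝ) (H : Finset (Finset (Fin n))) : ℝ :=
  s ^ H.card * (1 - s) ^ ((dsets n d).card - H.card)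

/-- Conditional mass function of the noisy projection `A` given the hypergraph `H`:
edges of `P(H)` kept with probability `p`, other pairs added with probability `q`. -/
def condP (n : ℕ) (p q : ℝ) (H A : Finset (Finset (Fin n))) : ℝ :=
  p ^ (A ∩ proj n H).card * (1 - p) ^ (proj n H \ A).card *
    q ^ (A \ proj n H).card * (1 - q) ^ ((pairs n \ proj n H) \ A).card

/-- Erdős–Rényi `G(n,q)` mass function. -/
def er (n : ℕ) (q : ℝ) (A : Finset (Finset (Fin n))) : ℝ :=
  q ^ A.card * (1 - q) ^ ((pairs n).card - A.card)

/-- Joint planted mass function of `(H, A)` under `ℙ`. -/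
def joint (n d : ℕ) (s p q : ℝ) (H A : Finset (Finset (Fin n))) : ℝ :=
  mu n d s H * condP n p q H A

/-- Marginal law of `A` under the planted measure `ℙ`. -/
def marg (n d : ℕ) (s p q : ℝ) (A : Finset (Finset (Fin n))) : ℝ :=
  ∑ H ∈ (dsets n d).powerset, joint n d s p q H A

/-- Probability of an event under the joint planted law `ℙ`. -/
def prJoint (n d : ℕ) (s p q : ℝ)
    (E : Finset (Finset (Fin n)) → Finset (Finset (Fin n)) → Prop) : ℝ :=
  ∑ H ∈ (dsets n d).powerset, ∑ A ∈ (pairs n).powerset,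
    if E H A then joint n d s p q H A else 0

/-- Probability of an event under the Erdős–Rényi law. -/
def prER (n : ℕ) (q : ℝ) (E : Finset (Finset (Fin n)) → Prop) : ℝ :=
  ∑ A ∈ (pairs n).powerset, if E A then er n q A else 0

/-- The clique estimator `Ĥ(A)`: all `d`-subsets of `[n]` that form a clique in `A`. -/
def cliqueEst (n d : ℕ) (A : Finset (Finset (Fin n))) : Finset (Finset (Fin n)) :=
  (dsets n d).filter fun Ψ => ∀ e ∈ pairs n, e ⊆ Ψ → e ∈ A


lemma sum_split {ι : Type*} [DecidableEq ι] (S : Finset ι) (f g : ι → ℝ) :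
    ∑ A ∈ S.powerset, (∏ i ∈ A, f i) * ∏ i ∈ S \ A, g i = ∏ i ∈ S, (f i + g i) := by
  rw [Finset.prod_add]

lemma er_eq (n : ℕ) (q : ℝ) (A : Finset (Finset (Fin n))) (hA : A ∈ (pairs n).powerset) :
    er n q A = (∏ _e ∈ A, q) * ∏ _e ∈ pairs n \ A, (1 - q) := by
  rw [Finset.mem_powerset] at hA
  simp only [Finset.prod_const, er]
  rw [Finset.card_sdiff_of_subset hA]

lemma mu_eq (n d : ℕ) (s : ℝ) (A : Finset (Finset (Fin n))) (hA : A ∈ (dsets n d).powerset) :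
    mu n d s A = (∏ _e ∈ A, s) * ∏ _e ∈ dsets n d \ A, (1 - s) := by
  rw [Finset.mem_powerset] at hA
  simp only [Finset.prod_const, mu]
  rw [Finset.card_sdiff_of_subset hA]

lemma condP_eq (n : ℕ) (p q : ℝ) (H A : Finset (Finset (Fin n))) (hA : A ∈ (pairs n).powerset) :
    condP n p q H A = (∏ e ∈ A, if e ∈ proj n H then p else q) *
      ∏ e ∈ pairs n \ A, (if e ∈ proj n H then 1 - p else 1 - q) := by
  rw [Finset.mem_powerset] at hA
  have hP : proj n H ⊆ pairs n := Finset.filter_subset _ _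
  rw [Finset.prod_ite, Finset.prod_ite]
  simp only [Finset.prod_const, condP]
  have h1 : (A.filter fun e => e ∈ proj n H) = A ∩ proj n H := by ext; simp
  have h2 : (A.filter fun e => e ∉ proj n H) = A \ proj n H := by ext; simp
  have h3 : ((pairs n \ A).filter fun e => e ∈ proj n H) = proj n H \ A := by
    ext e; simp only [Finset.mem_filter, Finset.mem_sdiff]
    have := @hP e
    tauto
  have h4 : ((pairs n \ A).filter fun e => e ∉ proj n H) = (pairs n \ proj n H) \ A := by
    ext e; simp only [Finset.mem_filter, Finset.mem_sdiff]
    tauto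
  rw [h1, h2, h3, h4]
  ring

lemma sum_er (n : ℕ) (q : ℝ) : ∑ A ∈ (pairs n).powerset, er n q A = 1 := by
  rw [Finset.sum_congr rfl (er_eq n q), sum_split]
  simp

lemma sum_mu (n d : ℕ) (s : ℝ) : ∑ A ∈ (dsets n d).powerset, mu n d s A = 1 := by
  rw [Finset.sum_congr rfl (mu_eq n d s), sum_split]
  simp

lemma sum_condP (n : ℕ) (p q : ℝ) (H : Finset (Finset (Fin n))) :
    ∑ A ∈ (pairs n).powerset, condP n p q H A = 1 := by
  rw [Finset.sum_congr rfl (condP_eq n p q H), sum_split]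
  apply Finset.prod_eq_one
  intro e _
  split_ifs <;> ring

lemma sum_marg (n d : ℕ) (s p q : ℝ) :
    ∑ A ∈ (pairs n).powerset, marg n d s p q A = 1 := by
  unfold marg joint
  rw [Finset.sum_comm]
  simp_rw [← Finset.mul_sum, sum_condP, mul_one]
  exact sum_mu n d s

lemma mu_nonneg (n d : ℕ) (s : ℝ) (h0 : 0 ≤ s) (h1 : s ≤ 1) (H : Finset (Finset (Fin n))) :
    0 ≤ mu n d s H := by
  have : 0 ≤ 1 - s := by linarith
  unfold mu; positivity

lemma er_pos (n : ℕ) (q : ℝ) (h0 : 0 < q) (h1 : q < 1) (H : Finset (Finset (Fin n))) :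
    0 < er n q H := by
  have : 0 < 1 - q := by linarith
  unfold er; positivity

lemma er_nonneg (n : ℕ) (q : ℝ) (h0 : 0 ≤ q) (h1 : q ≤ 1) (H : Finset (Finset (Fin n))) :
    0 ≤ er n q H := by
  have : 0 ≤ 1 - q := by linarith
  unfold er; positivity

lemma marg_nonneg (n d : ℕ) (s p q : ℝ) (h0 : 0 ≤ s) (h1 : s ≤ 1) (hp0 : 0 ≤ p) (hp1 : p ≤ 1)
    (hq0 : 0 ≤ q) (hq1 : q ≤ 1) (A : Finset (Finset (Fin n))) :
    0 ≤ marg n d s p q A := by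
  have : 0 ≤ 1 - q := by linarith
  have : 0 ≤ 1 - p := by linarith
  unfold marg joint
  refine Finset.sum_nonneg fun H _ => mul_nonneg (mu_nonneg n d s h0 h1 H) ?_
  unfold condP; positivity

/-- Second moment of two conditional laws relative to Erdős–Rényi. -/
lemma sum_cross (n : ℕ) (p q : ℝ) (h0 : 0 < q) (h1 : q < 1) (H H' : Finset (Finset (Fin n))) :
    ∑ A ∈ (pairs n).powerset, condP n p q H A * condP n p q H' A / er n q A =
      (1 + (p - q) ^ 2 / (q * (1 - q))) ^ (proj n H ∩ proj n H').card := by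
  have hq : (1 - q) ≠ 0 := by linarith
  have hq0 : q ≠ 0 := h0.ne'
  have hP : proj n H ⊆ pairs n := Finset.filter_subset _ _
  have key : ∀ A ∈ (pairs n).powerset, condP n p q H A * condP n p q H' A / er n q A =
      (∏ e ∈ A, ((if e ∈ proj n H then p else q) * (if e ∈ proj n H' then p else q) / q)) *
      ∏ e ∈ pairs n \ A, ((if e ∈ proj n H then 1 - p else 1 - q) *
        (if e ∈ proj n H' then 1 - p else 1 - q) / (1 - q)) := by
    intro A hA
    rw [condP_eq n p q H A hA, condP_eq n p q H' A hA, er_eq n q A hA]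
    rw [Finset.prod_div_distrib, Finset.prod_div_distrib, Finset.prod_mul_distrib,
      Finset.prod_mul_distrib, div_mul_div_comm]
    congr 1
    ring
  rw [Finset.sum_congr rfl key, sum_split]
  have : ∀ e ∈ pairs n, ((if e ∈ proj n H then p else q) * (if e ∈ proj n H' then p else q) / q) +
      ((if e ∈ proj n H then 1 - p else 1 - q) *
        (if e ∈ proj n H' then 1 - p else 1 - q) / (1 - q)) =
      if e ∈ proj n H ∩ proj n H' then (1 + (p - q) ^ 2 / (q * (1 - q))) else 1 := by
    intro e _
    by_cases a : e ∈ proj n H <;> by_cases b : e ∈ proj n H' <;>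
      simp only [a, b, if_true, if_false, Finset.mem_inter, and_true, and_false, and_self,
        false_and] <;> field_simp <;> ring
  rw [Finset.prod_congr rfl this, Finset.prod_ite_mem, Finset.prod_const]
  congr 2
  apply Finset.inter_eq_right.mpr
  exact (Finset.inter_subset_left).trans hP

lemma second_moment (n d : ℕ) (s p q : ℝ) (h0 : 0 < q) (h1 : q < 1) :
    ∑ A ∈ (pairs n).powerset, marg n d s p q A ^ 2 / er n q A =
      ∑ H ∈ (dsets n d).powerset, mu n d s H * ∑ H' ∈ (dsets n d).powerset, mu n d s H' *
      (1 + (p - q) ^ 2 / (q * (1 - q))) ^ (proj n H' ∩ proj n H).card := by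
  simp_rw [← sum_cross n p q h0 h1]
  have : ∀ A ∈ (pairs n).powerset, marg n d s p q A ^ 2 / er n q A =
     ∑ H ∈ (dsets n d).powerset, ∑ H' ∈ (dsets n d).powerset, mu n d s H * (mu n d s H' *
      (condP n p q H' A * condP n p q H A / er n q A)) := by
    intro A _
    unfold marg joint
    rw [sq, Finset.sum_mul_sum, Finset.sum_div]
    refine Finset.sum_congr rfl fun H _ => ?_
    rw [Finset.sum_div]
    refine Finset.sum_congr rfl fun H' _ => ?_
    ring
  rw [Finset.sum_congr rfl this, Finset.sum_comm]
  refine Finset.sum_congr rfl fun H _ => ?_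
  rw [Finset.sum_comm, Finset.mul_sum]
  refine Finset.sum_congr rfl fun H' _ => ?_
  rw [Finset.mul_sum, Finset.mul_sum]

lemma tv_sq_le (n d : ℕ) (s p q : ℝ) (h0 : 0 < q) (h1 : q < 1) :
    (∑ A ∈ (pairs n).powerset, |marg n d s p q A - er n q A|) ^ 2 ≤
      ∑ A ∈ (pairs n).powerset, marg n d s p q A ^ 2 / er n q A - 1 := by
  have hpos := er_pos n q h0 h1
  have h := Finset.sum_sq_le_sum_mul_sum_of_sq_eq_mul (pairs n).powerset
    (r := fun A => |marg n d s p q A - er n q A|)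
    (f := fun A => er n q A) (g := fun A => (marg n d s p q A - er n q A) ^ 2 / er n q A)
    (fun A _ => (hpos A).le) (fun A _ => div_nonneg (sq_nonneg _) (hpos A).le)
    (fun A _ => by rw [sq_abs]; have := (hpos A).ne'; field_simp)
  rw [sum_er, one_mul] at h
  refine h.trans (le_of_eq ?_)
  have : ∀ A ∈ (pairs n).powerset, (marg n d s p q A - er n q A) ^ 2 / er n q A =
      marg n d s p q A ^ 2 / er n q A - 2 * marg n d s p q A + er n q A := by
    intro A _
    have := (hpos A).ne'
    field_simp
    ring
  rw [Finset.sum_congr rfl this, Finset.sum_add_distrib, Finset.sum_sub_distrib, ← Finset.mul_sum,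
    sum_er, sum_marg]
  ring

lemma mgf_bound (n d : ℕ) (s : ℝ) (h0 : 0 ≤ s) (h1 : s ≤ 1) (x : Finset (Fin n) → ℝ) 
    (hx : ∀ e, 1 ≤ x e) :
    ∑ H ∈ (dsets n d).powerset, mu n d s H * ∏ e ∈ H, x e ≤
      Real.exp (s * ∑ e ∈ dsets n d, (x e - 1)) := by
  have : ∀ H ∈ (dsets n d).powerset, mu n d s H * ∏ e ∈ H, x e =
      (∏ e ∈ H, s * x e) * ∏ _e ∈ dsets n d \ H, (1 - s) := by
    intro H hH
    rw [mu_eq n d s H hH, Finset.prod_mul_distrib]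
    ring
  rw [Finset.sum_congr rfl this, sum_split, Finset.mul_sum, Real.exp_sum]
  refine Finset.prod_le_prod (fun e _ => ?_) (fun e _ => ?_)
  · have := mul_nonneg h0 (zero_le_one.trans (hx e)); linarith
  · have := Real.add_one_le_exp (s * (x e - 1)); linarith

lemma count_sup (n d : ℕ) (hd : 2 ≤ d) (e : Finset (Fin n)) (he : e ∈ pairs n) :
    ((dsets n d).filter fun Ψ => e ⊆ Ψ).card ≤ n ^ (d - 2) := by
  have he2 : e.card = 2 := (Finset.mem_powersetCard.mp he).2
  calc _ ≤ ((Finset.univ : Finset (Fin n)).powersetCard (d - 2)).card := by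
        refine Finset.card_le_card_of_injOn (fun Ψ => Ψ \ e) ?_ ?_
        · intro Ψ hΨ
          simp only [dsets, Finset.coe_filter, Finset.mem_powersetCard, Set.mem_ofPred_eq] at hΨ
          simp only [Finset.mem_coe, Finset.mem_powersetCard]
          refine ⟨Finset.subset_univ _, ?_⟩
          rw [Finset.card_sdiff_of_subset hΨ.2, hΨ.1.2, he2]
        · intro Ψ hΨ Ψ' hΨ' h
          simp only [dsets, Finset.coe_filter, Finset.mem_powersetCard, Set.mem_ofPred_eq] at hΨ hΨ'
          simp only at h
          rw [← Finset.sdiff_union_of_subset hΨ.2, h, Finset.sdiff_union_of_subset hΨ'.2]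
    _ = n.choose (d - 2) := by simp
    _ ≤ _ := Nat.choose_le_pow _ _

lemma dsets_card (n d : ℕ) : (dsets n d).card ≤ n ^ d := by
  simp only [dsets, Finset.card_powersetCard, Finset.card_univ, Fintype.card_fin]
  exact Nat.choose_le_pow _ _

lemma pairs_in_card (n d : ℕ) (F : Finset (Finset (Fin n))) (hF : F ⊆ pairs n)
    (Ψ : Finset (Fin n)) (hΨ : Ψ ∈ dsets n d) :
    (F.filter fun e => e ⊆ Ψ).card ≤ d.choose 2 := by
  have : (F.filter fun e => e ⊆ Ψ) ⊆ Ψ.powersetCard 2 := by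
    intro e he
    rw [Finset.mem_filter] at he
    exact Finset.mem_powersetCard.mpr ⟨he.2, (Finset.mem_powersetCard.mp (hF he.1)).2⟩
  refine (Finset.card_le_card this).trans ?_
  rw [Finset.card_powersetCard, (Finset.mem_powersetCard.mp hΨ).2]

lemma proj_inter_card (n : ℕ) (H F : Finset (Finset (Fin n))) :
    (proj n H ∩ F).card ≤ ∑ Ψ ∈ H, (F.filter fun e => e ⊆ Ψ).card := by
  refine le_trans (Finset.card_le_card ?_) Finset.card_biUnion_le
  intro e he
  simp only [proj, Finset.mem_inter, Finset.mem_filter, Finset.mem_biUnion] at he ⊢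
  obtain ⟨⟨_, Ψ, h1, h2⟩, h3⟩ := he
  exact ⟨Ψ, h1, h3, h2⟩

lemma proj_card (n d : ℕ) (H : Finset (Finset (Fin n))) (hH : H ⊆ dsets n d) :
    (proj n H).card ≤ H.card * d.choose 2 := by
  have h := proj_inter_card n H (pairs n)
  rw [Finset.inter_eq_left.mpr (show proj n H ⊆ pairs n from Finset.filter_subset _ _)] at h
  refine h.trans (Finset.sum_le_card_nsmul _ _ _ fun Ψ hΨ => ?_)
  exact pairs_in_card n d _ subset_rfl Ψ (hH hΨ)

lemma pow_sub_one_le (g : ℝ) (h0 : 0 ≤ g) (h1 : g ≤ 1) (k D : ℕ) (hk : k ≤ D) :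
    (1 + g) ^ k - 1 ≤ 2 ^ D * g * k := by
  induction k with
  | zero => simp
  | succ k ih =>
    have ih := ih (by omega)
    have h2 : (1 + g) ^ k ≤ 2 ^ D :=
      (pow_le_pow_left₀ (by linarith) (by linarith : 1 + g ≤ 2) k).trans
        (pow_le_pow_right₀ (by norm_num) (by omega))
    rw [pow_succ]
    push_cast
    nlinarith [mul_le_mul_of_nonneg_right h2 h0]

lemma inner_bound (n d : ℕ) (hd : 2 ≤ d) (s g : ℝ) (h0 : 0 ≤ s) (h1 : s ≤ 1)
    (hg0 : 0 ≤ g) (hg1 : g ≤ 1) (F : Finset (Finset (Fin n))) (hF : F ⊆ pairs n) :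
    ∑ H ∈ (dsets n d).powerset, mu n d s H * (1 + g) ^ (proj n H ∩ F).card ≤
      Real.exp (s * (2 ^ (d.choose 2) * g * (n ^ (d - 2) * F.card))) := by
  have hw : 1 ≤ 1 + g := by linarith
  calc _ ≤ ∑ H ∈ (dsets n d).powerset, mu n d s H *
        ∏ Ψ ∈ H, (1 + g) ^ (F.filter fun e => e ⊆ Ψ).card := by
        refine Finset.sum_le_sum fun H _ => mul_le_mul_of_nonneg_left ?_ (mu_nonneg n d s h0 h1 H)
        rw [Finset.prod_pow_eq_pow_sum]
        exact pow_le_pow_right₀ hw (proj_inter_card n H F)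
    _ ≤ _ := mgf_bound n d s h0 h1 _ (fun Ψ => one_le_pow₀ hw)
    _ ≤ _ := by
        refine Real.exp_le_exp.mpr (mul_le_mul_of_nonneg_left ?_ h0)
        calc _ ≤ ∑ Ψ ∈ dsets n d, 2 ^ (d.choose 2) * g * ((F.filter fun e => e ⊆ Ψ).card : ℝ) :=
              Finset.sum_le_sum fun Ψ hΨ => pow_sub_one_le g hg0 hg1 _ _ (pairs_in_card n d F hF Ψ hΨ)
          _ = 2 ^ (d.choose 2) * g * ((∑ Ψ ∈ dsets n d, (F.filter fun e => e ⊆ Ψ).card : ℕ) : ℝ) := by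
              rw [← Finset.mul_sum]; push_cast; rfl
          _ ≤ _ := by
              refine mul_le_mul_of_nonneg_left ?_ (by positivity)
              have : ∑ Ψ ∈ dsets n d, (F.filter fun e => e ⊆ Ψ).card ≤ n ^ (d - 2) * F.card := by
                have e1 : ∑ Ψ ∈ dsets n d, (F.filter fun e => e ⊆ Ψ).card =
                    ∑ e ∈ F, ((dsets n d).filter fun Ψ => e ⊆ Ψ).card := by
                  simp_rw [Finset.card_filter]
                  exact Finset.sum_comm
                rw [e1, mul_comm]
                exact Finset.sum_le_card_nsmul _ _ _ fun e he => count_sup n d hd e (hF he)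
              exact_mod_cast this

lemma chi_bound (n d : ℕ) (hd : 2 ≤ d) (s p q : ℝ) (h0 : 0 ≤ s) (h1 : s ≤ 1)
    (hq0 : 0 < q) (hq1 : q ≤ 1 / 2) (hqp : q ≤ p) (hg : 2 * (p ^ 2 / q) ≤ 1)
    (ht : (2 ^ (d.choose 2) * d.choose 2 * 2) * (n ^ (d - 2) * s * (p ^ 2 / q)) ≤ 1) :
    ∑ A ∈ (pairs n).powerset, marg n d s p q A ^ 2 / er n q A ≤
      Real.exp ((2 ^ (d.choose 2) * d.choose 2 * 4) *
        (n ^ d * s * (n ^ (d - 2) * s * (p ^ 2 / q)))) := by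
  rw [second_moment n d s p q hq0 (by linarith)]
  set g := (p - q) ^ 2 / (q * (1 - q)) with hgdef
  have hq1' : 0 < 1 - q := by linarith
  have hg0 : 0 ≤ g := by positivity
  have hg2 : g ≤ 2 * (p ^ 2 / q) := by
    rw [hgdef, mul_div_assoc', div_le_div_iff₀ (by positivity) hq0]
    have a : (p - q) ^ 2 ≤ p ^ 2 := by nlinarith
    have b : p ^ 2 ≤ 2 * p ^ 2 * (1 - q) := by nlinarith [sq_nonneg p]
    calc _ ≤ (2 * p ^ 2 * (1 - q)) * q := mul_le_mul_of_nonneg_right (a.trans b) hq0.le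
      _ = _ := by ring
  have hg1 : g ≤ 1 := hg2.trans hg
  set D : ℝ := ((d.choose 2 : ℕ) : ℝ) with hD
  have hD0 : 0 ≤ D := Nat.cast_nonneg _
  set t : ℝ := (2 ^ (d.choose 2) * D * 2) * (n ^ (d - 2) * s * (p ^ 2 / q)) with htd
  have ht0 : 0 ≤ t := by positivity
  have step : ∀ H ∈ (dsets n d).powerset, mu n d s H * ∑ H' ∈ (dsets n d).powerset, mu n d s H' *
      (1 + g) ^ (proj n H' ∩ proj n H).card ≤ mu n d s H * ∏ _e ∈ H, Real.exp t := by
    intro H hH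
    refine mul_le_mul_of_nonneg_left ?_ (mu_nonneg n d s h0 h1 H)
    refine (inner_bound n d hd s g h0 h1 hg0 hg1 _ (Finset.filter_subset _ _)).trans ?_
    rw [Finset.prod_const, ← Real.exp_nat_mul]
    refine Real.exp_le_exp.mpr ?_
    have hc : ((proj n H).card : ℝ) ≤ H.card * D := by
      rw [hD]
      exact_mod_cast proj_card n d H (Finset.mem_powerset.mp hH)
    calc s * (2 ^ (d.choose 2) * g * (n ^ (d - 2) * (proj n H).card))
        ≤ s * (2 ^ (d.choose 2) * (2 * (p ^ 2 / q)) * (n ^ (d - 2) * (H.card * D))) := by gcongr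
      _ = _ := by rw [htd]; ring
  refine (Finset.sum_le_sum step).trans ?_
  refine (mgf_bound n d s h0 h1 (fun _ => Real.exp t) (fun _ => Real.one_le_exp ht0)).trans ?_
  refine Real.exp_le_exp.mpr ?_
  rw [Finset.sum_const, nsmul_eq_mul]
  have he : Real.exp t - 1 ≤ 2 * t := by
    have := Real.abs_exp_sub_one_le (x := t) (by rw [abs_of_nonneg ht0]; exact ht)
    rw [abs_of_nonneg ht0] at this
    exact (le_abs_self _).trans this
  have hN : ((dsets n d).card : ℝ) ≤ n ^ d := by exact_mod_cast dsets_card n d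
  calc s * ((dsets n d).card * (Real.exp t - 1)) ≤ s * (n ^ d * (2 * t)) := by
        refine mul_le_mul_of_nonneg_left ?_ h0
        exact mul_le_mul hN he (by have := Real.one_le_exp ht0; linarith) (by positivity)
    _ = _ := by rw [htd]; ring

lemma tendsto_zero_of_log (x : ℕ → ℝ) (c : ℝ) (hc : c < 0) (hx : ∀ᶠ n in atTop, 0 < x n)
    (h : Tendsto (fun n : ℕ => Real.log (x n) / Real.log n) atTop (nhds c)) :
    Tendsto x atTop (nhds 0) := by
  have hl : Tendsto (fun n : ℕ => Real.log (n : ℝ)) atTop atTop :=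
    Real.tendsto_log_atTop.comp tendsto_natCast_atTop_atTop
  have h2 := Real.tendsto_exp_atBot.comp (h.neg_mul_atTop hc hl)
  refine h2.congr' ?_
  filter_upwards [hx, hl.eventually_gt_atTop 0] with n hn hn2
  simp only [Function.comp]
  rw [div_mul_cancel₀ _ hn2.ne', Real.exp_log hn]

lemma pos_of_log (x : ℕ → ℝ) (c : ℝ) (hc : c < 0) (hx : ∀ n, 0 ≤ x n)
    (h : Tendsto (fun n : ℕ => Real.log (x n) / Real.log n) atTop (nhds c)) :
    ∀ᶠ n in atTop, 0 < x n := by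
  filter_upwards [h.eventually_lt_const hc] with n hn
  rcases (hx n).lt_or_eq with h | h
  · exact h
  · rw [← h] at hn; simp at hn

lemma detect_aux (n d : ℕ) (s p q : ℝ) (f : Finset (Finset (Fin n)) → Bool) :
    1 - ∑ A ∈ (pairs n).powerset, |marg n d s p q A - er n q A| ≤
      (∑ A ∈ (pairs n).powerset, if f A = false then marg n d s p q A else 0) +
        (∑ A ∈ (pairs n).powerset, if f A = true then er n q A else 0) := by
  rw [← sum_er n q, ← Finset.sum_sub_distrib, ← Finset.sum_add_distrib]
  refine Finset.sum_le_sum fun A _ => ?_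
  have h1 := neg_abs_le (marg n d s p q A - er n q A)
  have h2 := abs_nonneg (marg n d s p q A - er n q A)
  cases f A <;> simp <;> linarith

lemma detect_upper (n d : ℕ) (s p q : ℝ) (hm : ∀ A, 0 ≤ marg n d s p q A)
    (he : ∀ A, 0 ≤ er n q A) (f : Finset (Finset (Fin n)) → Bool) :
      (∑ A ∈ (pairs n).powerset, if f A = false then marg n d s p q A else 0) +
        (∑ A ∈ (pairs n).powerset, if f A = true then er n q A else 0) ≤ 2 := by
  have h1 : (∑ A ∈ (pairs n).powerset, if f A = false then marg n d s p q A else 0) ≤ 1 := by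
    rw [← sum_marg n d s p q]
    refine Finset.sum_le_sum fun A _ => ?_
    split_ifs
    exacts [le_rfl, hm A]
  have h2 : (∑ A ∈ (pairs n).powerset, if f A = true then er n q A else 0) ≤ 1 := by
    rw [← sum_er n q]
    refine Finset.sum_le_sum fun A _ => ?_
    split_ifs
    exacts [le_rfl, he A]
  linarith

/-- when `β > 2(δ+α) − 1`, the total variation distance between the marginal
law of `A` under `ℙ` and the Erdős–Rényi law `ℚ` tends to `0`; consequently no sequence of
tests achieves even weak detection. -/
theorem tv_to_zero_and_no_weak_detection
    (d : ℕ) (hd : 2 ≤ d) (δ α β : ℝ)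
    (hδ : 0 ≤ δ ∧ δ < 1) (hβα : 0 ≤ β ∧ β ≤ α ∧ α ≤ 1)
    (hgap : 2 * (δ + α) - 1 < β)
    (s p q : ℕ → ℝ)
    (hs01 : ∀ n, 0 < s n ∧ s n ≤ 1)
    (hp01 : ∀ n, 0 ≤ p n ∧ p n ≤ 1)
    (hq01 : ∀ n, 0 ≤ q n ∧ q n ≤ 1)
    (hqp : ∀ n, q n ≤ p n)
    (hs : Tendsto (fun n : ℕ => Real.log (s n) / Real.log n) atTop
      (nhds (-((d : ℝ) - 1) + δ)))
    (hp : Tendsto (fun n : ℕ => Real.log (p n) / Real.log n) atTop (nhds (-1 + α)))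
    (hq : Tendsto (fun n : ℕ => Real.log (q n) / Real.log n) atTop (nhds (-1 + β))) :
    Tendsto (fun n : ℕ =>
        (1 / 2) * ∑ A ∈ (pairs n).powerset,
          |marg n d (s n) (p n) (q n) A - er n (q n) A|) atTop (nhds 0) ∧
      ∀ f : (n : ℕ) → Finset (Finset (Fin n)) → Bool,
        1 ≤ atTop.liminf (fun n : ℕ =>
          (∑ A ∈ (pairs n).powerset,
            if f n A = false then marg n d (s n) (p n) (q n) A else 0) +
          (∑ A ∈ (pairs n).powerset,
            if f n A = true then er n (q n) A else 0)) := by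
  obtain ⟨hδ0, hδ1⟩ := hδ
  obtain ⟨hβ0, hβα, hα1⟩ := hβα
  have hα : α < 1 := by linarith
  have hβ : β < 1 := by linarith
  have hl : Tendsto (fun n : ℕ => Real.log (n : ℝ)) atTop atTop :=
    Real.tendsto_log_atTop.comp tendsto_natCast_atTop_atTop
  have hppos := pos_of_log p _ (by linarith) (fun n => (hp01 n).1) hp
  have hqpos := pos_of_log q _ (by linarith) (fun n => (hq01 n).1) hq
  have hq0 := tendsto_zero_of_log q _ (by linarith) hqpos hq
  have hgood : ∀ᶠ n : ℕ in atTop, 0 < p n ∧ 0 < q n ∧ 0 < (n : ℝ) ∧ 0 < Real.log n := by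
    filter_upwards [hppos, hqpos, hl.eventually_gt_atTop 0, eventually_gt_atTop 0] with n a b c e
    exact ⟨a, b, by exact_mod_cast e, c⟩
  -- the three vanishing quantities
  have hgam : Tendsto (fun n => p n ^ 2 / q n) atTop (nhds 0) := by
    refine tendsto_zero_of_log _ (2 * (-1 + α) - (-1 + β)) (by linarith) ?_ ?_
    · filter_upwards [hgood] with n ⟨a, b, c, e⟩
      positivity
    · refine ((hp.const_mul 2).sub hq).congr' ?_
      filter_upwards [hgood] with n ⟨a, b, c, e⟩
      rw [Real.log_div (by positivity) b.ne', Real.log_pow]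
      push_cast
      ring
  have hd2 : ((d - 2 : ℕ) : ℝ) = (d : ℝ) - 2 := by
    push_cast [Nat.cast_sub hd]; ring
  have hlogn : Tendsto (fun n : ℕ => Real.log (n : ℝ) / Real.log n) atTop (nhds 1) := by
    refine tendsto_const_nhds.congr' ?_
    filter_upwards [hgood] with n ⟨a, b, c, e⟩
    rw [div_self e.ne']
  have hlogt : Tendsto (fun n : ℕ => Real.log ((n : ℝ) ^ (d - 2) * s n * (p n ^ 2 / q n)) /
      Real.log n) atTop (nhds (((d : ℝ) - 2) * 1 + (-((d : ℝ) - 1) + δ) +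
        (2 * (-1 + α) - (-1 + β)))) := by
    refine (((hlogn.const_mul ((d : ℝ) - 2)).add hs).add ((hp.const_mul 2).sub hq)).congr' ?_
    filter_upwards [hgood] with n ⟨a, b, c, e⟩
    have := (hs01 n).1
    rw [Real.log_mul (by positivity) (by positivity), Real.log_mul (by positivity) (by positivity),
      Real.log_div (by positivity) b.ne', Real.log_pow, Real.log_pow, hd2]
    push_cast
    ring
  have ht : Tendsto (fun n : ℕ => (n : ℝ) ^ (d - 2) * s n * (p n ^ 2 / q n)) atTop (nhds 0) := by
    refine tendsto_zero_of_log _ _ (by linarith) ?_ hlogt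
    filter_upwards [hgood] with n ⟨a, b, c, e⟩
    have := (hs01 n).1
    positivity
  have hX : Tendsto (fun n : ℕ => (n : ℝ) ^ d * s n * ((n : ℝ) ^ (d - 2) * s n * (p n ^ 2 / q n)))
      atTop (nhds 0) := by
    refine tendsto_zero_of_log _ ((d : ℝ) * 1 + (-((d : ℝ) - 1) + δ) +
      (((d : ℝ) - 2) * 1 + (-((d : ℝ) - 1) + δ) + (2 * (-1 + α) - (-1 + β)))) (by linarith) ?_ ?_
    · filter_upwards [hgood] with n ⟨a, b, c, e⟩
      have := (hs01 n).1
      positivity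
    · refine (((hlogn.const_mul (d : ℝ)).add hs).add hlogt).congr' ?_
      filter_upwards [hgood] with n ⟨a, b, c, e⟩
      have := (hs01 n).1
      rw [Real.log_mul (x := (n : ℝ) ^ d * s n) (by positivity) (by positivity),
        Real.log_mul (x := (n : ℝ) ^ d) (by positivity) (by positivity), Real.log_pow (n : ℝ) d]
      ring
  have hsum : Tendsto (fun n : ℕ => ∑ A ∈ (pairs n).powerset,
      |marg n d (s n) (p n) (q n) A - er n (q n) A|) atTop (nhds 0) := by
    have hb : Tendsto (fun n : ℕ => Real.sqrt (Real.exp ((2 ^ (d.choose 2) * d.choose 2 * 4) *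
        ((n : ℝ) ^ d * s n * ((n : ℝ) ^ (d - 2) * s n * (p n ^ 2 / q n)))) - 1)) atTop
        (nhds 0) := by
      have := ((Real.continuous_exp.tendsto _).comp
        (hX.const_mul (2 ^ (d.choose 2) * d.choose 2 * 4 : ℝ))).sub_const 1
      have := (Real.continuous_sqrt.tendsto _).comp this
      simpa [Function.comp_def] using this
    refine squeeze_zero' (Eventually.of_forall fun n => Finset.sum_nonneg fun A _ => abs_nonneg _)
      ?_ hb
    have e1 := (hgam.const_mul 2).eventually_le_const (u := 1) (by norm_num)
    have e2 := (ht.const_mul (2 ^ (d.choose 2) * d.choose 2 * 2 : ℝ)).eventually_le_const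
      (u := 1) (by norm_num)
    have e3 := hq0.eventually_le_const (u := 1 / 2) (by norm_num)
    filter_upwards [hgood, e1, e2, e3] with n ⟨a, b, c, e⟩ e1 e2 e3
    refine Real.le_sqrt_of_sq_le ?_
    refine (tv_sq_le n d (s n) (p n) (q n) b (by linarith)).trans ?_
    have := chi_bound n d hd (s n) (p n) (q n) (hs01 n).1.le (hs01 n).2 b e3 (hqp n) e1 e2
    linarith
  refine ⟨by simpa only [mul_zero] using hsum.const_mul (1 / 2 : ℝ), fun f => ?_⟩
  have hlow : Tendsto (fun n : ℕ => 1 - ∑ A ∈ (pairs n).powerset,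
      |marg n d (s n) (p n) (q n) A - er n (q n) A|) atTop (nhds 1) := by
    simpa using hsum.const_sub 1
  rw [← hlow.liminf_eq]
  refine liminf_le_liminf (Eventually.of_forall fun n => detect_aux n d (s n) (p n) (q n) (f n))
    hlow.isBoundedUnder_ge ?_
  refine IsBoundedUnder.isCoboundedUnder_ge ⟨2, ?_⟩
  rw [eventually_map]
  refine Eventually.of_forall fun n => detect_upper n d (s n) (p n) (q n) (fun A => ?_) (fun A => ?_) (f n)
  · exact marg_nonneg n d _ _ _ (hs01 n).1.le (hs01 n).2 (hp01 n).1 (hp01 n).2 (hq01 n).1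
      (hq01 n).2 A
  · exact er_nonneg n _ (hq01 n).1 (hq01 n).2 A

end NoisyHypergraph
end
end

section
/- Fix n, d and parameters 0 < q ≤ p ≤ 1 with q < 1. For any two fixed d-uniform hypergraphs H and H' on [n], E_{A∼G(n,q)}[ L_H(A) · L_{H'}(A) ] = ( p²/q + (1−p)²/(1−q) )^{ |E(P(H)) ∩ E(P(H'))| }. -/
open Finset Filter
open scoped Classical symmDiff

noncomputable section

namespace NoisyHypergraph

lemma condP_eq_prod (n : ℕ) (p q : ℝ) (H A : Finset (Finset (Fin n))) (hA : A ⊆ pairs n) :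
    condP n p q H A = (∏ e ∈ A, if e ∈ proj n H then p else q) *
      ∏ e ∈ pairs n \ A, if e ∈ proj n H then 1 - p else 1 - q := by
  have hP : proj n H ⊆ pairs n := Finset.filter_subset _ _
  rw [Finset.prod_ite, Finset.prod_ite]
  simp only [Finset.prod_const]
  have h1 : A.filter (fun e => e ∈ proj n H) = A ∩ proj n H := by
    ext e; simp
  have h2 : A.filter (fun e => e ∉ proj n H) = A \ proj n H := by
    ext e; simp
  have h3 : (pairs n \ A).filter (fun e => e ∈ proj n H) = proj n H \ A := by
    ext e
    have := @hP e
    simp only [Finset.mem_filter, Finset.mem_sdiff]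
    tauto
  have h4 : (pairs n \ A).filter (fun e => e ∉ proj n H) = (pairs n \ proj n H) \ A := by
    ext e
    simp only [Finset.mem_filter, Finset.mem_sdiff]
    tauto
  rw [h1, h2, h3, h4, condP]
  ring

lemma er_eq_prod (n : ℕ) (q : ℝ) (A : Finset (Finset (Fin n))) (hA : A ⊆ pairs n) :
    er n q A = (∏ _e ∈ A, q) * ∏ _e ∈ pairs n \ A, (1 - q) := by
  simp only [Finset.prod_const, er, Finset.card_sdiff_of_subset hA]

/-- for fixed hypergraphs `H, H'`, the null expectation of the product of the
conditional likelihood ratios `L_H(A)·L_{H'}(A)` equals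
`(p²/q + (1−p)²/(1−q))^{|E(P(H)) ∩ E(P(H'))|}`. -/
theorem replica_pair_expectation
    (n d : ℕ) (hd : 2 ≤ d) (p q : ℝ)
    (hq0 : 0 < q) (hqp : q ≤ p) (hp1 : p ≤ 1) (hq1 : q < 1)
    (H H' : Finset (Finset (Fin n)))
    (hH : H ∈ (dsets n d).powerset) (hH' : H' ∈ (dsets n d).powerset) :
    ∑ A ∈ (pairs n).powerset,
        er n q A * (condP n p q H A / er n q A) * (condP n p q H' A / er n q A)
      = (p ^ 2 / q + (1 - p) ^ 2 / (1 - q)) ^ (proj n H ∩ proj n H').card := by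
  have hq : q ≠ 0 := hq0.ne'
  have hq' : 1 - q ≠ 0 := by linarith
  have hP : proj n H ⊆ pairs n := Finset.filter_subset _ _
  have key : ∀ A ∈ (pairs n).powerset,
      er n q A * (condP n p q H A / er n q A) * (condP n p q H' A / er n q A) =
      (∏ e ∈ A, (if e ∈ proj n H then p else q) * (if e ∈ proj n H' then p else q) / q) *
      ∏ e ∈ pairs n \ A, (if e ∈ proj n H then 1 - p else 1 - q) *
        (if e ∈ proj n H' then 1 - p else 1 - q) / (1 - q) := by
    intro A hA
    have hA' := Finset.mem_powerset.mp hA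
    have he : er n q A ≠ 0 := by
      unfold er
      exact mul_ne_zero (pow_ne_zero _ hq) (pow_ne_zero _ hq')
    rw [mul_div_cancel₀ _ he, Finset.prod_div_distrib, Finset.prod_div_distrib,
      Finset.prod_mul_distrib, Finset.prod_mul_distrib, div_mul_div_comm,
      ← er_eq_prod n q A hA', condP_eq_prod n p q H A hA', condP_eq_prod n p q H' A hA']
    ring
  rw [Finset.sum_congr rfl key, ← Finset.prod_add]
  have h2 : ∀ e ∈ pairs n,
      (if e ∈ proj n H then p else q) * (if e ∈ proj n H' then p else q) / q +
      (if e ∈ proj n H then 1 - p else 1 - q) *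
        (if e ∈ proj n H' then 1 - p else 1 - q) / (1 - q) =
      if e ∈ proj n H ∩ proj n H' then p ^ 2 / q + (1 - p) ^ 2 / (1 - q) else 1 := by
    intro e _
    by_cases h : e ∈ proj n H <;> by_cases h' : e ∈ proj n H' <;>
      simp only [h, h', Finset.mem_inter, and_self, and_false, false_and, if_true, if_false] <;>
      field_simp <;> ring
  rw [Finset.prod_congr rfl h2, Finset.prod_ite_mem,
    Finset.inter_eq_right.mpr (Finset.inter_subset_left.trans hP), Finset.prod_const]

end NoisyHypergraph
end
end

section
/- Let h(H,H') = |E(P(H)) ∩ E(P(H'))| for d-uniform hypergraphs H, H' on [n]. Then: (a) if the pair (H₁,H₁') differs from the pair (H₂,H₂') by adding or removing a single hyperedge in one of the two coordinates, then |h(H₁,H₁') − h(H₂,H₂')| ≤ C(d,2); and (b) for every pair (H,H') and every integer σ ≥ 0 with h(H,H') ≥ σ, there exist subsets I ⊆ H and I' ⊆ H' with |I| + |I'| ≤ 2σ such that every pair of hypergraphs (H̃,H̃') with I ⊆ H̃ and I' ⊆ H̃' satisfies h(H̃,H̃') ≥ σ. (That is, h is C(d,2)-Lipschitz in the hyperedge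 indicators and certifiable with certificate size 2σ.) -/
open Finset Filter
open scoped Classical symmDiff

noncomputable section

namespace NoisyHypergraph

theorem proj_mono_aux {n : ℕ} {H K : Finset (Finset (Fin n))} (h : H ⊆ K) :
    proj n H ⊆ proj n K := by
  intro x hx
  simp only [proj, Finset.mem_filter] at hx ⊢
  obtain ⟨hx, Ψ, hΨ, hs⟩ := hx
  exact ⟨hx, Ψ, h hΨ, hs⟩

theorem lip_aux {n d : ℕ} {H K C : Finset (Finset (Fin n))} {e : Finset (Fin n)}
    (he : e ∈ dsets n d) (h : H ⊆ K) (h2 : ∀ x ∈ K, x = e ∨ x ∈ H) :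
    (proj n H ∩ C).card ≤ (proj n K ∩ C).card ∧
    (proj n K ∩ C).card ≤ (proj n H ∩ C).card + d.choose 2 := by
  constructor
  · exact Finset.card_le_card (Finset.inter_subset_inter_right (proj_mono_aux h))
  · have hc : (e.powersetCard 2).card = d.choose 2 := by
      rw [Finset.card_powersetCard, (Finset.mem_powersetCard.1 he).2]
    rw [← hc]
    refine le_trans (Finset.card_le_card ?_) (Finset.card_union_le _ _)
    intro x hx
    simp only [proj, pairs, Finset.mem_filter, Finset.mem_inter, Finset.mem_union,
      Finset.mem_powersetCard] at hx ⊢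
    obtain ⟨⟨hx, Ψ, hΨ, hs⟩, hC⟩ := hx
    rcases h2 Ψ hΨ with rfl | hH
    · exact Or.inr ⟨hs, hx.2⟩
    · exact Or.inl ⟨⟨hx, Ψ, hH, hs⟩, hC⟩

theorem lip_insert_aux {n d : ℕ} {H C : Finset (Finset (Fin n))} {e : Finset (Fin n)}
    (he : e ∈ dsets n d) :
    |((proj n (insert e H) ∩ C).card : ℤ) - ((proj n H ∩ C).card : ℤ)| ≤ (d.choose 2 : ℤ) := by
  have := lip_aux (C := C) he (Finset.subset_insert e H) (fun x hx => Finset.mem_insert.1 hx)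
  rw [abs_le]
  omega

theorem lip_erase_aux {n d : ℕ} {H C : Finset (Finset (Fin n))} {e : Finset (Fin n)}
    (he : e ∈ dsets n d) :
    |((proj n (H.erase e) ∩ C).card : ℤ) - ((proj n H ∩ C).card : ℤ)| ≤ (d.choose 2 : ℤ) := by
  have := lip_aux (C := C) he (Finset.erase_subset e H)
    (fun x hx => (em (x = e)).imp id (fun h => Finset.mem_erase.2 ⟨h, hx⟩))
  rw [abs_le]
  omega

theorem cert_aux {n : ℕ} {H S : Finset (Finset (Fin n))} (hS : S ⊆ proj n H) :
    ∃ I ⊆ H, I.card ≤ S.card ∧ S ⊆ proj n I := by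
  have h : ∀ x ∈ S, ∃ Ψ ∈ H, x ⊆ Ψ := fun x hx => (Finset.mem_filter.1 (hS hx)).2
  choose! f hf hs using h
  refine ⟨S.image f, ?_, Finset.card_image_le, ?_⟩
  · intro y hy
    obtain ⟨x, hx, rfl⟩ := Finset.mem_image.1 hy
    exact hf x hx
  · intro x hx
    exact Finset.mem_filter.2 ⟨(Finset.mem_filter.1 (hS hx)).1, f x,
      Finset.mem_image_of_mem f hx, hs x hx⟩

/-- `h(H,H') = |E(P(H)) ∩ E(P(H'))|` is `C(d,2)`-Lipschitz with respect to
adding/removing a single hyperedge in either coordinate, and is certifiable with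
certificate size `2σ`. -/
theorem intersection_lipschitz_certifiable (n d : ℕ) (hd : 2 ≤ d) :
    (∀ H H' : Finset (Finset (Fin n)), ∀ e ∈ dsets n d,
      (|((proj n (insert e H) ∩ proj n H').card : ℤ)
          - ((proj n H ∩ proj n H').card : ℤ)| ≤ (d.choose 2 : ℤ)) ∧
      (|((proj n H ∩ proj n (insert e H')).card : ℤ)
          - ((proj n H ∩ proj n H').card : ℤ)| ≤ (d.choose 2 : ℤ)) ∧
      (|((proj n (H.erase e) ∩ proj n H').card : ℤ)
          - ((proj n H ∩ proj n H').card : ℤ)| ≤ (d.choose 2 : ℤ)) ∧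
      (|((proj n H ∩ proj n (H'.erase e)).card : ℤ)
          - ((proj n H ∩ proj n H').card : ℤ)| ≤ (d.choose 2 : ℤ))) ∧
    (∀ H H' : Finset (Finset (Fin n)), ∀ σ : ℕ,
      σ ≤ (proj n H ∩ proj n H').card →
      ∃ I I' : Finset (Finset (Fin n)), I ⊆ H ∧ I' ⊆ H' ∧ I.card + I'.card ≤ 2 * σ ∧
        ∀ Ht Ht' : Finset (Finset (Fin n)), I ⊆ Ht → I' ⊆ Ht' →
          σ ≤ (proj n Ht ∩ proj n Ht').card) := by
  refine ⟨fun H H' e he => ⟨lip_insert_aux he, ?_, lip_erase_aux he, ?_⟩, ?_⟩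
  · rw [Finset.inter_comm, Finset.inter_comm (proj n H)]
    exact lip_insert_aux he
  · rw [Finset.inter_comm, Finset.inter_comm (proj n H)]
    exact lip_erase_aux he
  · intro H H' σ hσ
    obtain ⟨S, hS, hc⟩ := Finset.exists_subset_card_eq hσ
    obtain ⟨I, hI, hIc, hSI⟩ := cert_aux (hS.trans Finset.inter_subset_left)
    obtain ⟨I', hI', hIc', hSI'⟩ := cert_aux (hS.trans Finset.inter_subset_right)
    refine ⟨I, I', hI, hI', by omega, fun Ht Ht' h h' => ?_⟩
    rw [← hc]
    exact Finset.card_le_card (Finset.subset_inter (hSI.trans (proj_mono_aux h))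
      (hSI'.trans (proj_mono_aux h')))
end NoisyHypergraph
end
end
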